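/- arXiv:1711.05092 — 5 statements merged into one kernel-verified Lean document; each statement's English description precedes it below -/
import Mathlib

section
/- Every non-degenerate best-k scoring rule is monotonically robust: if the ballot profile A' reinforces some candidate c relative to A and W_{A'} ≠ W_A, then W_{A'} = {c} ∪ (W_A \ {c'}) for some c' ∈ W_A. -/
open Finset

/-- The 0-indexed rank of candidate `c` within committee `W` with respect to the utility `u`:
the number of members of `W` strictly preferred to `c`.  Thus the most preferred member of `W`
has rank `0`. -/
noncomputable def owaRank {C : Type*} (u : C → ℝ) (W : Finset C) (c : C) : ℕ :=
  (W.filter fun c' => u c < u c').card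

/-- The OWA set-extension utility determined by the weights `lam` (where `lam 0` is the weight
`λ₁` put on the most preferred committee member, `lam 1` is `λ₂`, and so on) and the
utility function `u`. -/
noncomputable def owaUtil {C : Type*} (lam : ℕ → ℝ) (u : C → ℝ) (W : Finset C) : ℝ :=
  ∑ c ∈ W, lam (owaRank u W c) * u c

/-- The approval score of candidate `c` under the ballot profile `A`. -/
def score {N C : Type*} [Fintype N] [DecidableEq C] (A : N → Finset C) (c : C) : ℕ :=
  (Finset.univ.filter fun i => c ∈ A i).card

/-- Candidate `c` is ranked above candidate `c'` by the best-`k` scoring rule with scoring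
function `g`, with ties broken by the priority order: `c < c'` means `c` has higher
priority (`c ▷ c'`). -/
def beats {N C : Type*} [Fintype N] [DecidableEq C] [LT C]
    (g : C → ℕ → ℝ) (A : N → Finset C) (c c' : C) : Prop :=
  g c' (score A c') < g c (score A c) ∨
    (g c (score A c) = g c' (score A c') ∧ c < c')

open Classical in
/-- The winning committee: the `k` top-ranked candidates. -/
noncomputable def winners {N C : Type*} [Fintype N] [Fintype C] [DecidableEq C] [LT C]
    (g : C → ℕ → ℝ) (k : ℕ) (A : N → Finset C) : Finset C :=
  Finset.univ.filter fun c => (Finset.univ.filter fun c' => beats g A c' c).card < k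

/-- `B` is a best-response ballot of voter `i` against the other voters' ballots in `A`. -/
def BestResponse {N C : Type*} [Fintype N] [DecidableEq N] [Fintype C] [DecidableEq C] [LT C]
    (g : C → ℕ → ℝ) (k : ℕ) (lam : ℕ → ℝ) (u : C → ℝ)
    (A : N → Finset C) (i : N) (B : Finset C) : Prop :=
  ∀ B' : Finset C,
    owaUtil lam u (winners g k (Function.update A i B')) ≤
      owaUtil lam u (winners g k (Function.update A i B))

/-- `B` is a minimal best-response ballot of voter `i`. -/
def MinimalBestResponse {N C : Type*} [Fintype N] [DecidableEq N] [Fintype C] [DecidableEq C]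
    [LT C] (g : C → ℕ → ℝ) (k : ℕ) (lam : ℕ → ℝ) (u : C → ℝ)
    (A : N → Finset C) (i : N) (B : Finset C) : Prop :=
  BestResponse g k lam u A i B ∧
    ∀ B' : Finset C, BestResponse g k lam u A i B' → B.card ≤ B'.card

/-- A ballot profile is a lazy pure Nash equilibrium if every voter's ballot is a minimal
best response to the other voters' ballots. -/
def LazyPNE {N C : Type*} [Fintype N] [DecidableEq N] [Fintype C] [DecidableEq C] [LT C]
    (g : C → ℕ → ℝ) (k : ℕ) (lam : N → ℕ → ℝ) (u : N → C → ℝ) (A : N → Finset C) : Prop :=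
  ∀ i, MinimalBestResponse g k (lam i) (u i) A i (A i)

/-- A ballot is sincere if every approved candidate is preferred to every unapproved one. -/
def Sincere {C : Type*} (u : C → ℝ) (B : Finset C) : Prop :=
  ∀ c ∈ B, ∀ c' ∉ B, u c' < u c

open Classical in
/-- For a strict total order `r` on a finite type, exactly `k` elements have fewer than `k`
predecessors. -/
theorem card_filter_card_predecessors_lt {α : Type*} [Fintype α] (r : α → α → Prop)
    (irrefl : ∀ a, ¬ r a a) (trans : ∀ a b c, r a b → r b c → r a c)
    (total : ∀ a b, a ≠ b → r a b ∨ r b a) {k : ℕ} (hk : k ≤ Fintype.card α) :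
    (univ.filter fun a => (univ.filter fun b => r b a).card < k).card = k := by
  set f : α → ℕ := fun a => (univ.filter fun b => r b a).card with hf
  have strict : ∀ a b, r a b → f a < f b := fun a b hab => by
    refine card_lt_card (ssubset_iff_of_subset (fun x hx => ?_) |>.2 ⟨a, ?_, ?_⟩)
    · simp only [mem_filter, mem_univ, true_and] at hx ⊢
      exact trans _ _ _ hx hab
    · simpa using hab
    · simpa using irrefl a
  have inj : Function.Injective f := fun a b hab => by
    by_contra hne
    rcases total a b hne with h | h
    · exact (strict _ _ h).ne hab
    · exact (strict _ _ h).ne hab.symm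
  have image_eq : univ.image f = range (Fintype.card α) := by
    refine eq_of_subset_of_card_le (fun n hn => ?_) ?_
    · obtain ⟨a, -, rfl⟩ := mem_image.1 hn
      exact mem_range.2 (card_lt_univ_of_notMem (x := a) (by simpa using irrefl a))
    · rw [card_image_of_injective _ inj, card_range, card_univ]
  have image_filter : (univ.filter fun a => f a < k).image f = range k := by
    ext n
    simp only [mem_image, mem_filter, mem_univ, true_and, mem_range]
    refine ⟨fun ⟨a, ha, h⟩ => h ▸ ha, fun hn => ?_⟩
    obtain ⟨a, -, rfl⟩ := mem_image.1 (image_eq ▸ mem_range.2 (hn.trans_le hk))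
    exact ⟨a, hn, rfl⟩
  rw [← card_image_of_injective _ inj, image_filter, card_range]

theorem card_winners {N C : Type*} [Fintype N] [Fintype C] [LinearOrder C]
    (g : C → ℕ → ℝ) {k : ℕ} (hk : k ≤ Fintype.card C) (A : N → Finset C) :
    (winners g k A).card = k := by
  refine card_filter_card_predecessors_lt (beats g A) (fun a => ?_) (fun a b c => ?_)
    (fun a b hab => ?_) hk
  · simp [beats]
  · rintro (h | ⟨h, h'⟩) (h₁ | ⟨h₁, h₁'⟩)
    · exact Or.inl (h₁.trans h)
    · exact Or.inl (h₁ ▸ h)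
    · exact Or.inl (h ▸ h₁)
    · exact Or.inr ⟨h.trans h₁, h'.trans h₁'⟩
  · rcases lt_trichotomy (g a (score A a)) (g b (score A b)) with h | h | h
    · exact Or.inr (Or.inl h)
    · exact hab.lt_or_gt.imp (fun h' => Or.inr ⟨h, h'⟩) (fun h' => Or.inr ⟨h.symm, h'⟩)
    · exact Or.inl (Or.inl h)

theorem score_update_insert_of_ne {N C : Type*} [Fintype N] [DecidableEq N] [DecidableEq C]
    (A : N → Finset C) (i : N) {c x : C} (hx : x ≠ c) :
    score (Function.update A i (insert c (A i))) x = score A x := by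
  refine congrArg card (filter_congr fun j _ => ?_)
  rcases eq_or_ne j i with rfl | hj <;> simp [*]

theorem score_le_score_update_insert {N C : Type*} [Fintype N] [DecidableEq N] [DecidableEq C]
    (A : N → Finset C) (i : N) (c : C) :
    score A c ≤ score (Function.update A i (insert c (A i))) c := by
  refine card_le_card (monotone_filter_right _ fun j _ h => ?_)
  rcases eq_or_ne j i with rfl | hj <;> simp [*]

/-- Raising the score of `c` alone cannot turn another losing candidate into a winner. -/
theorem winners_subset_insert {N C : Type*} [Fintype N] [Fintype C] [LinearOrder C]
    (g : C → ℕ → ℝ) (hg : ∀ c, Monotone (g c)) (k : ℕ) {A A' : N → Finset C} {c : C}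
    (hc : score A c ≤ score A' c) (hne : ∀ x, x ≠ c → score A' x = score A x) :
    winners g k A' ⊆ insert c (winners g k A) := by
  classical
  intro x hx
  rcases eq_or_ne x c with rfl | hxc
  · exact mem_insert_self _ _
  refine mem_insert_of_mem ?_
  simp only [winners, mem_filter, mem_univ, true_and] at hx ⊢
  refine (card_le_card (monotone_filter_right _ fun y _ hy => ?_)).trans_lt hx
  rcases eq_or_ne y c with rfl | hyc
  · have hle := hg y hc
    rw [beats, hne x hxc]
    rcases hy with h | ⟨h, h'⟩
    · exact Or.inl (h.trans_le hle)
    · rcases hle.lt_or_eq with hlt | heq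
      · exact Or.inl (h ▸ hlt)
      · exact Or.inr ⟨heq ▸ h, h'⟩
  · rwa [beats, hne x hxc, hne y hyc]

/-- Two distinct finsets of equal size, one contained in the other up to the element `c`,
differ by exchanging a single element for `c`. -/
theorem exists_eq_insert_erase_of_subset_insert {α : Type*} [DecidableEq α] {s t : Finset α}
    {c : α} (hcard : t.card = s.card) (hsub : t ⊆ insert c s) (hne : t ≠ s) :
    ∃ c' ∈ s, t = insert c (s.erase c') := by
  have hct : c ∈ t := by
    by_contra h
    exact hne (eq_of_subset_of_card_le ((subset_insert_iff_of_notMem h).1 hsub) hcard.ge)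
  have hcs : c ∉ s := fun h =>
    hne (eq_of_subset_of_card_le (by rwa [insert_eq_of_mem h] at hsub) hcard.ge)
  have hsub' : t.erase c ⊆ s := subset_insert_iff.1 hsub
  obtain ⟨c', hc's, hc't⟩ : ∃ c' ∈ s, c' ∉ t := by
    by_contra! h
    exact hne (eq_of_subset_of_card_le h hcard.le).symm
  refine ⟨c', hc's, eq_of_subset_of_card_le (fun x hx => ?_) ?_⟩
  · rcases eq_or_ne x c with rfl | hxc
    · exact mem_insert_self _ _
    · exact mem_insert_of_mem (mem_erase.2
        ⟨fun h => hc't (h ▸ hx), hsub' (mem_erase.2 ⟨hxc, hx⟩)⟩)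
  · rw [card_insert_of_notMem fun h => hcs (mem_of_mem_erase h), card_erase_add_one hc's, hcard]

/-- every non-degenerate best-`k` scoring rule is monotonically robust. -/
theorem statement_2 {N C : Type*} [Fintype N] [DecidableEq N] [Fintype C] [LinearOrder C]
    (k : ℕ) (hk1 : 1 ≤ k) (hk2 : k ≤ Fintype.card C)
    (g : C → ℕ → ℝ) (hg : ∀ c, StrictMono (g c)) (hg0 : ∀ c, g c 0 = 0)
    (A A' : N → Finset C) (c : C)
    (hreinf : ∃ i : N, c ∉ A i ∧ A' = Function.update A i (insert c (A i)))
    (hne : winners g k A' ≠ winners g k A) :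
    ∃ c' ∈ winners g k A, winners g k A' = insert c ((winners g k A).erase c') := by
  obtain ⟨i, -, rfl⟩ := hreinf
  exact exists_eq_insert_erase_of_subset_insert
    ((card_winners g hk2 _).trans (card_winners g hk2 _).symm)
    (winners_subset_insert g (fun x => (hg x).monotone) k
      (score_le_score_update_insert A i c) fun _ hx => score_update_insert_of_ne A i hx)
    hne
end

section
/- For the AV-rule with lexicographic tie-breaking, suppose voter i has j* = j*(i), suppose R is a positive integer with R < j*, and suppose the set of the k highest-priority candidates under ▷ is disjoint from W_i*. Let A_{-i} be the profile in which A_j = ∅ for every voter j ≠ i. Then for every ballot A_i' ⊆ C with |A_i'| ≤ R, we have U_i(W_{(A_i', A_{-i})}) < U_i(W_{(W_i*, A_{-i})}); that is, an R ballot-length restriction is constraining for voter i. -/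
open Finset

section OwaRank

variable {C : Type*} {u : C → ℝ} {W : Finset C}

theorem owaRank_lt_card {c : C} (hc : c ∈ W) : owaRank u W c < W.card := by
  apply Finset.card_lt_card
  refine ⟨Finset.filter_subset _ _, fun h => ?_⟩
  simpa using h hc

theorem owaRank_lt_of_lt {c d : C} (hd : d ∈ W) (h : u c < u d) :
    owaRank u W d < owaRank u W c := by
  apply Finset.card_lt_card
  refine ⟨fun x hx => ?_, fun hs => ?_⟩
  · simp only [Finset.mem_filter] at hx ⊢
    exact ⟨hx.1, h.trans hx.2⟩
  · have := hs (Finset.mem_filter.2 ⟨hd, h⟩)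
    simp at this

theorem owaRank_injOn (hu : Function.Injective u) :
    Set.InjOn (owaRank u W) (W : Set C) := by
  intro c hc d hd h
  rcases lt_trichotomy (u c) (u d) with hlt | heq | hgt
  · exact absurd h (owaRank_lt_of_lt hd hlt).ne'
  · exact hu heq
  · exact absurd h (owaRank_lt_of_lt hc hgt).ne

theorem exists_owaRank_eq (hu : Function.Injective u) {j : ℕ} (hj : j < W.card) :
    ∃ c ∈ W, owaRank u W c = j := by
  have h := Finset.surjOn_of_injOn_of_card_le (s := W) (t := Finset.range W.card) (owaRank u W)
    (fun c hc => by simpa using owaRank_lt_card hc) (owaRank_injOn hu) (by simp)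
  obtain ⟨c, hc, hcj⟩ := h (show j ∈ (Finset.range W.card : Set ℕ) by simpa using hj)
  exact ⟨c, hc, hcj⟩

end OwaRank

section TopSet

variable {C : Type*} {u : C → ℝ} {lam : ℕ → ℝ} {S W : Finset C}

/-- Committees containing the set `S` of favourites give the same utility as `S` itself when
weights beyond `S.card` vanish. -/
theorem owaUtil_eq_of_top_subset (hz : ∀ n, S.card ≤ n → lam n = 0)
    (htop : ∀ c ∈ S, ∀ c' ∉ S, u c' < u c) (hSW : S ⊆ W) :
    owaUtil lam u W = owaUtil lam u S := by
  unfold owaUtil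
  rw [← Finset.sum_subset hSW]
  · refine Finset.sum_congr rfl fun c hc => ?_
    congr 2
    unfold owaRank
    congr 1
    ext x
    simp only [Finset.mem_filter]
    refine ⟨fun hx => ⟨?_, hx.2⟩, fun hx => ⟨hSW hx.1, hx.2⟩⟩
    by_contra hxS
    exact lt_asymm hx.2 (htop c hc x hxS)
  · intro c hcW hcS
    rw [hz, zero_mul]
    refine Finset.card_le_card fun x hx => ?_
    exact Finset.mem_filter.2 ⟨hSW hx, htop x hx c hcS⟩

theorem le_of_owaRank_eq (htop : ∀ c ∈ S, ∀ c' ∉ S, u c' < u c) {c d : C}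
    (hd : d ∈ S) (h : owaRank u W c = owaRank u S d) : u c ≤ u d := by
  by_contra! hlt
  have hsub : (W.filter fun x => u c < u x) ⊂ S.filter fun x => u d < u x := by
    have hS : ∀ x, u d < u x → x ∈ S := fun x hx => by
      by_contra hxS
      exact lt_asymm hx (htop d hd x hxS)
    refine ⟨fun x hx => ?_, fun hs => ?_⟩
    · have hx := (Finset.mem_filter.1 hx).2
      exact Finset.mem_filter.2 ⟨hS x (hlt.trans hx), hlt.trans hx⟩
    · have := hs (Finset.mem_filter.2 ⟨hS c hlt, hlt⟩)
      simp at this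
  exact (Finset.card_lt_card hsub).ne h

theorem lt_of_owaRank_last_of_not_subset (htop : ∀ c ∈ S, ∀ c' ∉ S, u c' < u c)
    (hSW : ¬ S ⊆ W) {c d : C} (hc : c ∈ W) (hd : d ∈ S) (h : owaRank u W c = owaRank u S d)
    (hlast : owaRank u S d + 1 = S.card) : u c < u d := by
  classical
  by_contra! hle
  have hS : ∀ x, u d ≤ u x → x ∈ S := fun x hx => by
    by_contra hxS
    exact absurd (htop d hd x hxS) hx.not_gt
  have hsub : insert c (W.filter fun x => u c < u x) ⊆ S := by
    intro x hx
    rcases Finset.mem_insert.1 hx with rfl | hx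
    · exact hS _ hle
    · exact hS x (hle.trans (Finset.mem_filter.1 hx).2.le)
  have hcard : S.card ≤ (insert c (W.filter fun x => u c < u x)).card := by
    rw [Finset.card_insert_of_notMem (by simp), ← hlast, ← h]
    rfl
  refine hSW ?_
  rw [← Finset.eq_of_subset_of_card_le hsub hcard]
  exact Finset.insert_subset hc (Finset.filter_subset _ _)

/-- If the last favourite in `S` carries positive weight, missing a member of `S` strictly
decreases the utility. -/
theorem owaUtil_lt_of_not_top_subset (hu : Function.Injective u) (hlam : ∀ n, 0 ≤ lam n)
    (hz : ∀ n, S.card ≤ n → lam n = 0) (hpos : 0 < lam (S.card - 1))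
    (htop : ∀ c ∈ S, ∀ c' ∉ S, u c' < u c) (hcard : S.card ≤ W.card) (hSW : ¬ S ⊆ W) :
    owaUtil lam u W < owaUtil lam u S := by
  classical
  have hex : ∀ d : C, ∃ c, d ∈ S → c ∈ W ∧ owaRank u W c = owaRank u S d := fun d => by
    by_cases hd : d ∈ S
    · obtain ⟨c, hc⟩ := exists_owaRank_eq hu ((owaRank_lt_card (u := u) hd).trans_le hcard)
      exact ⟨c, fun _ => hc⟩
    · exact ⟨d, fun h => absurd h hd⟩
  choose f hf using hex
  have hinj : Set.InjOn f (S : Set C) := fun d hd d' hd' h =>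
    owaRank_injOn hu hd hd' (by rw [← (hf d hd).2, ← (hf d' hd').2, h])
  have hW : owaUtil lam u W = ∑ d ∈ S, lam (owaRank u S d) * u (f d) := by
    have hsub : S.image f ⊆ W := Finset.image_subset_iff.2 fun d hd => (hf d hd).1
    unfold owaUtil
    rw [← Finset.sum_subset hsub, Finset.sum_image hinj]
    · exact Finset.sum_congr rfl fun d hd => by rw [(hf d hd).2]
    · intro c hc hcS
      rw [hz, zero_mul]
      by_contra! hlt
      obtain ⟨d, hd, hdc⟩ := exists_owaRank_eq hu hlt
      refine hcS (Finset.mem_image.2 ⟨d, hd, ?_⟩)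
      exact owaRank_injOn hu (hf d hd).1 hc ((hf d hd).2.trans hdc)
  rw [hW]
  have hScard : 0 < S.card := Finset.card_pos.2 <| Finset.nonempty_iff_ne_empty.2 fun h =>
    hSW (h ▸ Finset.empty_subset W)
  obtain ⟨d, hd, hdl⟩ := exists_owaRank_eq (j := S.card - 1) (W := S) hu (by omega)
  refine Finset.sum_lt_sum (fun x hx => ?_) ⟨d, hd, ?_⟩
  · exact mul_le_mul_of_nonneg_left (le_of_owaRank_eq htop hx (hf x hx).2) (hlam _)
  · refine mul_lt_mul_of_pos_left ?_ (hdl ▸ hpos)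
    exact lt_of_owaRank_last_of_not_subset htop hSW (hf d hd).1 hd (hf d hd).2 (by omega)

end TopSet

section Winners

variable {N C : Type*} [Fintype N]

theorem beats_trans [LinearOrder C] {g : C → ℕ → ℝ} {A : N → Finset C} {a b c : C}
    (hab : beats g A a b) (hbc : beats g A b c) : beats g A a c := by
  unfold beats at *
  grind

theorem not_beats_self [LinearOrder C] {g : C → ℕ → ℝ} {A : N → Finset C} {a : C} :
    ¬ beats g A a a := by
  simp [beats]

theorem le_card_winners [Fintype C] [LinearOrder C] (g : C → ℕ → ℝ) (A : N → Finset C) {k : ℕ}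
    (hk : k ≤ Fintype.card C) : k ≤ (winners g k A).card := by
  classical
  by_contra! hlt
  have hne : (winners g k A)ᶜ.Nonempty := by
    rw [← Finset.card_pos, Finset.card_compl]
    omega
  obtain ⟨c, hc, hmin⟩ := Finset.exists_min_image _
    (fun c => (Finset.univ.filter fun c' => beats g A c' c).card) hne
  refine Finset.mem_compl.1 hc (Finset.mem_filter.2 ⟨Finset.mem_univ c, ?_⟩)
  convert (Finset.card_le_card fun x hx => ?_).trans_lt hlt using 3
  have hxc := (Finset.mem_filter.1 hx).2
  by_contra hxW
  refine (hmin x (Finset.mem_compl.2 hxW)).not_gt (Finset.card_lt_card ⟨fun y hy => ?_, ?_⟩)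
  · exact Finset.mem_filter.2 ⟨Finset.mem_univ y, beats_trans (Finset.mem_filter.1 hy).2 hxc⟩
  · intro hs
    exact not_beats_self (Finset.mem_filter.1 (hs hx)).2

theorem score_update_empty [DecidableEq N] [DecidableEq C] (i : N) (B : Finset C) (c : C) :
    score (Function.update (fun _ : N => (∅ : Finset C)) i B) c = if c ∈ B then 1 else 0 := by
  unfold score
  have h : ∀ j, c ∈ Function.update (fun _ : N => (∅ : Finset C)) i B j ↔ j = i ∧ c ∈ B := by
    intro j
    by_cases hj : j = i
    · subst hj
      simp
    · simp [hj]
  simp only [h]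
  split_ifs with hc <;> simp [hc, Finset.filter_eq']

theorem beats_update_empty_iff [DecidableEq N] [LinearOrder C] (i : N) (B : Finset C) (c c' : C) :
    beats (fun _ n => (n : ℝ)) (Function.update (fun _ : N => (∅ : Finset C)) i B) c c' ↔
      (c ∈ B ∧ c' ∉ B) ∨ ((c ∈ B ↔ c' ∈ B) ∧ c < c') := by
  unfold beats
  rw [score_update_empty, score_update_empty]
  by_cases h : c ∈ B <;> by_cases h' : c' ∈ B <;> simp [h, h']

theorem subset_winners_update_empty [DecidableEq N] [Fintype C] [LinearOrder C] (i : N)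
    {B : Finset C} {k : ℕ} (hB : B.card ≤ k) :
    B ⊆ winners (fun _ n => (n : ℝ)) k (Function.update (fun _ : N => (∅ : Finset C)) i B) := by
  classical
  intro c hc
  refine Finset.mem_filter.2 ⟨Finset.mem_univ c, (Finset.card_lt_card ⟨?_, ?_⟩).trans_le hB⟩
  · intro x hx
    have := (beats_update_empty_iff i B x c).1 (Finset.mem_filter.1 hx).2
    tauto
  · intro hs
    exact not_beats_self (Finset.mem_filter.1 (hs hc)).2

theorem notMem_winners_update_empty [DecidableEq N] [Fintype C] [LinearOrder C] (i : N)
    {B T : Finset C} {c : C} (hcB : c ∉ B) (hT : ∀ t ∈ T, t < c) :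
    c ∉ winners (fun _ n => (n : ℝ)) T.card
      (Function.update (fun _ : N => (∅ : Finset C)) i B) := by
  classical
  intro hc
  refine (Finset.mem_filter.1 hc).2.not_ge (Finset.card_le_card fun t ht => ?_)
  refine Finset.mem_filter.2 ⟨Finset.mem_univ t, (beats_update_empty_iff i B t c).2 ?_⟩
  have := hT t ht
  tauto

end Winners

/-- for the AV-rule, if `R < j*(i)` and the `k` highest-priority candidates are
disjoint from `W_i*`, then against the profile where all other voters abstain, every ballot of
length at most `R` yields strictly less utility than the ballot `W_i*`: the `R` ballot-length
restriction is constraining for voter `i`. -/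
theorem statement_4 {N C : Type*} [Fintype N] [DecidableEq N] [Fintype C] [LinearOrder C]
    (k : ℕ) (hk1 : 1 ≤ k) (hk2 : k ≤ Fintype.card C)
    (u : C → ℝ) (hu : Function.Injective u)
    (lam : ℕ → ℝ) (hlam : ∀ n, 0 ≤ lam n)
    (jstar : ℕ) (hj1 : 1 ≤ jstar) (hjk : jstar ≤ k)
    (hz : ∀ n, jstar ≤ n → lam n = 0) (hpos : 0 < lam (jstar - 1))
    (R : ℕ) (hR1 : 1 ≤ R) (hR : R < jstar)
    (Wst : Finset C) (hWstcard : Wst.card = jstar)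
    (hWsttop : ∀ c ∈ Wst, ∀ c' ∉ Wst, u c' < u c)
    (T : Finset C) (hTcard : T.card = k) (hTtop : ∀ c ∈ T, ∀ c' ∉ T, c < c')
    (hdisj : Disjoint T Wst)
    (i : N) (B : Finset C) (hB : B.card ≤ R) :
    owaUtil lam u
        (winners (fun _ n => (n : ℝ)) k (Function.update (fun _ : N => (∅ : Finset C)) i B)) <
      owaUtil lam u
        (winners (fun _ n => (n : ℝ)) k
          (Function.update (fun _ : N => (∅ : Finset C)) i Wst)) := by
  subst hTcard hWstcard
  rw [owaUtil_eq_of_top_subset hz hWsttop (subset_winners_update_empty i hjk)]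
  obtain ⟨c, hc, hcB⟩ := Finset.exists_mem_notMem_of_card_lt_card (hB.trans_lt hR)
  have hTc : ∀ t ∈ T, t < c := fun t ht =>
    hTtop t ht c fun hcT => Finset.disjoint_left.1 hdisj hcT hc
  exact owaUtil_lt_of_not_top_subset hu hlam hz hpos hWsttop
    (hjk.trans (le_card_winners _ _ hk2))
    fun hs => notMem_winners_update_empty i hcB hTc (hs hc)
end

section
/- For a non-degenerate best-k scoring rule, for every voter i and every collection A_{-i} of the other voters' ballots, there exists a best response (BR) ballot A_i with |A_i| ≤ k; hence a ballot-length restriction R = k is non-constraining for every voter. -/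
open Finset

/-- The key by which candidates are sorted: higher value of `g` first, ties broken by priority. -/
noncomputable def rankKey {N C : Type*} [Fintype N] [DecidableEq C]
    (g : C → ℕ → ℝ) (A : N → Finset C) (c : C) : ℝᵒᵈ ×ₗ C :=
  toLex (OrderDual.toDual (g c (score A c)), c)

theorem rankKey_injective {N C : Type*} [Fintype N] [DecidableEq C]
    (g : C → ℕ → ℝ) (A : N → Finset C) : Function.Injective (rankKey g A) := by
  intro a b h
  exact congrArg (fun p => (ofLex p).2) h

theorem beats_iff_rankKey_lt {N C : Type*} [Fintype N] [LinearOrder C]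
    (g : C → ℕ → ℝ) (A : N → Finset C) (c c' : C) :
    beats g A c c' ↔ rankKey g A c < rankKey g A c' := by
  simp [beats, rankKey, Prod.Lex.toLex_lt_toLex]

/-- For an injective key, exactly `k` elements have fewer than `k` elements with a smaller key. -/
theorem card_filter_card_lt_lt {C α : Type*} [Fintype C] [LinearOrder α]
    {f : C → α} (hf : Function.Injective f) {k : ℕ} (hk : k ≤ Fintype.card C) :
    (univ.filter fun c => (univ.filter fun c' => f c' < f c).card < k).card = k := by
  classical
  set r : C → ℕ := fun c => (univ.filter fun c' => f c' < f c).card with hr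
  have hmono : ∀ a b, f a < f b → r a < r b := by
    intro a b hab
    refine card_lt_card (ssubset_iff_of_subset ?_ |>.mpr ⟨a, by simpa using hab, by simp⟩)
    intro c hc
    simp only [mem_filter, mem_univ, true_and] at hc ⊢
    exact hc.trans hab
  have hinj : Function.Injective r := by
    intro a b hab
    rcases lt_trichotomy (f a) (f b) with h | h | h
    · exact absurd hab (hmono _ _ h).ne
    · exact hf h
    · exact absurd hab (hmono _ _ h).ne'
  have hsub : univ.image r ⊆ range (Fintype.card C) := by
    intro n hn
    obtain ⟨c, -, rfl⟩ := mem_image.mp hn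
    refine mem_range.mpr (card_lt_univ_of_notMem (x := c) ?_)
    simp
  have himage : univ.image r = range (Fintype.card C) :=
    eq_of_subset_of_card_le hsub (by rw [card_image_of_injective _ hinj]; simp)
  have hrange : (univ.filter fun c => r c < k).image r = range k := by
    ext n
    simp only [mem_image, mem_filter, mem_univ, true_and, mem_range]
    constructor
    · rintro ⟨c, hc, rfl⟩
      exact hc
    · intro hn
      have : n ∈ univ.image r := himage ▸ mem_range.mpr (hn.trans_le hk)
      obtain ⟨c, -, rfl⟩ := mem_image.mp this
      exact ⟨c, hn, rfl⟩
  rw [← card_image_of_injective _ hinj, hrange, card_range]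

/-- If winners keep their scores and no score increases, the committee is unchanged. -/
theorem winners_eq_of_score_le {N C : Type*} [Fintype N] [Fintype C] [LinearOrder C]
    {g : C → ℕ → ℝ} (hg : ∀ c, Monotone (g c)) {k : ℕ} (hk : k ≤ Fintype.card C)
    {A A' : N → Finset C} (hle : ∀ c, score A' c ≤ score A c)
    (heq : ∀ c ∈ winners g k A, score A' c = score A c) :
    winners g k A' = winners g k A := by
  classical
  symm
  refine eq_of_subset_of_card_le (fun c hc => ?_)
    (by rw [card_winners g hk, card_winners g hk])
  have hscore := heq c hc
  simp only [winners, mem_filter, mem_univ, true_and] at hc ⊢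
  refine lt_of_le_of_lt (card_le_card fun c' hc' => ?_) hc
  refine mem_filter.mpr ⟨mem_univ _, ?_⟩
  simp only [mem_filter, mem_univ, true_and, beats, hscore] at hc' ⊢
  have hgle := hg c' (hle c')
  rcases hc' with h | ⟨h, hlt⟩
  · exact Or.inl (h.trans_le hgle)
  · rcases hgle.lt_or_eq with h' | h'
    · exact Or.inl (h ▸ h')
    · exact Or.inr ⟨h' ▸ h, hlt⟩

/-- Dropping the losing candidates from a ballot does not change the committee. -/
theorem winners_update_inter_winners {N C : Type*} [Fintype N] [DecidableEq N] [Fintype C]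
    [LinearOrder C] {g : C → ℕ → ℝ} (hg : ∀ c, Monotone (g c)) {k : ℕ}
    (hk : k ≤ Fintype.card C) (A : N → Finset C) (i : N) (B : Finset C) :
    winners g k (Function.update A i (B ∩ winners g k (Function.update A i B))) =
      winners g k (Function.update A i B) := by
  refine winners_eq_of_score_le hg hk (fun c => card_le_card fun j hj => ?_)
    (fun c hc => congrArg card (filter_congr fun j _ => ?_))
  · by_cases hji : j = i
    · subst hji
      simp_all
    · simpa [hji] using hj
  · by_cases hji : j = i
    · subst hji
      simp [hc]
    · simp [hji]

theorem exists_bestResponse {N C : Type*} [Fintype N] [DecidableEq N] [Fintype C]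
    [DecidableEq C] [LT C] (g : C → ℕ → ℝ) (k : ℕ) (lam : ℕ → ℝ) (u : C → ℝ)
    (A : N → Finset C) (i : N) : ∃ B : Finset C, BestResponse g k lam u A i B :=
  Finite.exists_max fun B => owaUtil lam u (winners g k (Function.update A i B))

/-- there always exists a best-response ballot of length at most `k`; hence the
ballot-length restriction `R = k` is non-constraining. -/
theorem statement_5 {N C : Type*} [Fintype N] [DecidableEq N] [Fintype C] [LinearOrder C]
    (k : ℕ) (hk1 : 1 ≤ k) (hk2 : k ≤ Fintype.card C)
    (g : C → ℕ → ℝ) (hg : ∀ c, StrictMono (g c)) (hg0 : ∀ c, g c 0 = 0)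
    (u : C → ℝ) (hu : Function.Injective u)
    (lam : ℕ → ℝ) (hlam : ∀ n, 0 ≤ lam n) (hlamne : ∃ n < k, lam n ≠ 0)
    (A : N → Finset C) (i : N) :
    ∃ B : Finset C, B.card ≤ k ∧ BestResponse g k lam u A i B := by
  obtain ⟨B, hB⟩ := exists_bestResponse g k lam u A i
  refine ⟨B ∩ winners g k (Function.update A i B), ?_, fun B' => ?_⟩
  · exact (card_le_card inter_subset_right).trans (card_winners g hk2 _).le
  · rw [winners_update_inter_winners (fun c => (hg c).monotone) hk2]
    exact hB B'
end

section
/- For the AV-rule with lexicographic tie-breaking, if A is a lazy-PNE with outcome W_A, then s(c,A) = 0 for every candidate c ∈ C \ W_A, and s(c,A) ≤ 1 for every candidate c ∈ W_A. -/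
open Finset

section ApprovalVoting

variable {N C : Type*} [Fintype N] [LinearOrder C]

theorem beats_av_iff (A : N → Finset C) (c c' : C) :
    beats (fun _ n => (n : ℝ)) A c c' ↔
      score A c' < score A c ∨ (score A c = score A c' ∧ c < c') := by
  simp [beats]

theorem beats_av_irrefl (A : N → Finset C) (c : C) : ¬ beats (fun _ n => (n : ℝ)) A c c := by
  simp [beats_av_iff]

theorem beats_av_trans {A : N → Finset C} {a b c : C}
    (hab : beats (fun _ n => (n : ℝ)) A a b) (hbc : beats (fun _ n => (n : ℝ)) A b c) :
    beats (fun _ n => (n : ℝ)) A a c := by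
  rw [beats_av_iff] at *
  rcases hab with hab | ⟨hab, hab'⟩ <;> rcases hbc with hbc | ⟨hbc, hbc'⟩
  · left; omega
  · left; omega
  · left; omega
  · exact Or.inr ⟨hab.trans hbc, hab'.trans hbc'⟩

theorem beats_av_total (A : N → Finset C) {a b : C} (h : a ≠ b) :
    beats (fun _ n => (n : ℝ)) A a b ∨ beats (fun _ n => (n : ℝ)) A b a := by
  rw [beats_av_iff, beats_av_iff]
  rcases lt_trichotomy (score A a) (score A b) with hs | hs | hs
  · exact Or.inr (Or.inl hs)
  · rcases h.lt_or_gt with h | h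
    · exact Or.inl (Or.inr ⟨hs, h⟩)
    · exact Or.inr (Or.inr ⟨hs.symm, h⟩)
  · exact Or.inl (Or.inl hs)

theorem score_update_of_mem_iff [DecidableEq N] {A : N → Finset C} {i : N} {B : Finset C} {x : C}
    (h : x ∈ B ↔ x ∈ A i) : score (Function.update A i B) x = score A x := by
  unfold score
  congr 1
  ext j
  by_cases hj : j = i
  · subst hj; simp [h]
  · simp [hj]

theorem score_update_erase_add_one [DecidableEq N] {A : N → Finset C} {i : N} {c : C}
    (h : c ∈ A i) : score (Function.update A i ((A i).erase c)) c + 1 = score A c := by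
  unfold score
  rw [← Finset.card_erase_add_one (a := i) (s := univ.filter fun j => c ∈ A j) (by simpa using h)]
  congr 2
  ext j
  by_cases hj : j = i
  · subst hj; simp
  · simp [hj]

variable [Fintype C]

open Classical in
/-- The number of candidates ranked above `c` by the AV-rule. -/
noncomputable def avRank (A : N → Finset C) (c : C) : ℕ :=
  (univ.filter fun c' => beats (fun _ n => (n : ℝ)) A c' c).card

theorem mem_winners_av_iff {k : ℕ} {A : N → Finset C} {c : C} :
    c ∈ winners (fun _ n => (n : ℝ)) k A ↔ avRank A c < k := by
  simp [winners, avRank]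

theorem avRank_lt_of_beats {A : N → Finset C} {a b : C}
    (h : beats (fun _ n => (n : ℝ)) A a b) : avRank A a < avRank A b := by
  classical
  refine card_lt_card ((ssubset_iff_of_subset fun x hx => ?_).2 ⟨a, ?_, ?_⟩)
  · exact mem_filter.2 ⟨mem_univ _, beats_av_trans (mem_filter.1 hx).2 h⟩
  · exact mem_filter.2 ⟨mem_univ _, h⟩
  · exact fun ha => beats_av_irrefl A a (mem_filter.1 ha).2

theorem avRank_injective (A : N → Finset C) : Function.Injective (avRank A) := by
  intro a b hab
  by_contra hne
  rcases beats_av_total A hne with h | h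
  · exact (avRank_lt_of_beats h).ne hab
  · exact (avRank_lt_of_beats h).ne hab.symm

theorem avRank_lt_card (A : N → Finset C) (c : C) : avRank A c < Fintype.card C := by
  classical
  exact card_lt_univ_of_notMem (x := c) fun h => beats_av_irrefl A c (mem_filter.1 h).2

theorem image_avRank_univ (A : N → Finset C) :
    univ.image (avRank A) = range (Fintype.card C) := by
  refine eq_of_subset_of_card_le (fun n hn => ?_) ?_
  · obtain ⟨c, -, rfl⟩ := mem_image.1 hn
    exact mem_range.2 (avRank_lt_card A c)
  · rw [card_image_of_injective _ (avRank_injective A), card_range, card_univ]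

theorem card_winners_av {k : ℕ} (hk : k ≤ Fintype.card C) (A : N → Finset C) :
    (winners (fun _ n => (n : ℝ)) k A).card = k := by
  rw [← card_image_of_injective _ (avRank_injective A)]
  suffices h : (winners (fun _ n => (n : ℝ)) k A).image (avRank A) = range k by
    rw [h, card_range]
  ext n
  simp only [mem_image, mem_winners_av_iff, mem_range]
  refine ⟨fun ⟨c, hc, hn⟩ => hn ▸ hc, fun hn => ?_⟩
  have hmem : n ∈ univ.image (avRank A) := by
    rw [image_avRank_univ]; exact mem_range.2 (hn.trans_le hk)
  obtain ⟨c, -, rfl⟩ := mem_image.1 hmem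
  exact ⟨c, hn, rfl⟩

theorem beats_of_mem_winners_av {k : ℕ} {A : N → Finset C} {w x : C}
    (hw : w ∈ winners (fun _ n => (n : ℝ)) k A) (hx : x ∉ winners (fun _ n => (n : ℝ)) k A) :
    beats (fun _ n => (n : ℝ)) A w x := by
  refine (beats_av_total A (ne_of_mem_of_not_mem hw hx)).resolve_right fun h => hx ?_
  exact mem_winners_av_iff.2 ((avRank_lt_of_beats h).trans (mem_winners_av_iff.1 hw))

/-- A set of `k` candidates each of which is ranked above every other candidate is the
winning committee. -/
theorem winners_av_eq_of_beats {k : ℕ} {A : N → Finset C} {W : Finset C} (hk : W.card = k)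
    (h : ∀ w ∈ W, ∀ x ∉ W, beats (fun _ n => (n : ℝ)) A w x) :
    winners (fun _ n => (n : ℝ)) k A = W := by
  classical
  refine eq_of_subset_of_card_le (fun w hw => ?_) ?_
  · by_contra hwW
    refine (mem_winners_av_iff.1 hw).not_ge (hk ▸ card_le_card fun x hx => ?_)
    exact mem_filter.2 ⟨mem_univ _, h x hx w hwW⟩
  · rw [hk, card_winners_av (hk ▸ card_le_univ W)]

/-- In a minimal best response, dropping an approval changes the winning committee. -/
theorem MinimalBestResponse.winners_update_erase_ne [DecidableEq N] {g : C → ℕ → ℝ} {k : ℕ}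
    {lam : ℕ → ℝ} {u : C → ℝ} {A : N → Finset C} {i : N}
    (h : MinimalBestResponse g k lam u A i (A i)) {c : C} (hc : c ∈ A i) :
    winners g k (Function.update A i ((A i).erase c)) ≠ winners g k A := by
  intro heq
  refine (card_erase_lt_of_mem hc).not_ge (h.2 _ fun B => ?_)
  have hB := h.1 B
  rwa [Function.update_eq_self, ← heq] at hB

theorem MinimalBestResponse.subset_winners_av [DecidableEq N] {k : ℕ}
    (hk : k ≤ Fintype.card C) {lam : ℕ → ℝ} {u : C → ℝ} {A : N → Finset C} {i : N}
    (h : MinimalBestResponse (fun _ n => (n : ℝ)) k lam u A i (A i)) :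
    A i ⊆ winners (fun _ n => (n : ℝ)) k A := by
  intro c hc
  by_contra hcW
  refine h.winners_update_erase_ne hc
    (winners_av_eq_of_beats (card_winners_av hk A) fun w hw x hx => ?_)
  have hwx := beats_of_mem_winners_av hw hx
  have hwc : w ≠ c := ne_of_mem_of_not_mem hw hcW
  rw [beats_av_iff] at hwx ⊢
  rw [score_update_of_mem_iff (x := w) (by simp [hwc])]
  by_cases hxc : x = c
  · subst hxc
    have := score_update_erase_add_one hc
    left; omega
  · rwa [score_update_of_mem_iff (by simp [hxc])]

theorem LazyPNE.score_eq_zero_of_notMem_winners_av [DecidableEq N] {k : ℕ}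
    (hk : k ≤ Fintype.card C) {lam : N → ℕ → ℝ} {u : N → C → ℝ} {A : N → Finset C}
    (h : LazyPNE (fun _ n => (n : ℝ)) k lam u A) {c : C}
    (hc : c ∉ winners (fun _ n => (n : ℝ)) k A) : score A c = 0 :=
  card_eq_zero.2 <| filter_eq_empty_iff.2 fun i _ hi => hc ((h i).subset_winners_av hk hi)

theorem LazyPNE.score_le_one_av [DecidableEq N] {k : ℕ}
    (hk : k ≤ Fintype.card C) {lam : N → ℕ → ℝ} {u : N → C → ℝ} {A : N → Finset C}
    (h : LazyPNE (fun _ n => (n : ℝ)) k lam u A) (c : C) : score A c ≤ 1 := by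
  by_contra! hlt
  obtain ⟨i, hi⟩ := card_pos.1 (zero_lt_one.trans hlt)
  have hc : c ∈ A i := (mem_filter.1 hi).2
  have hcW := (h i).subset_winners_av hk hc
  refine (h i).winners_update_erase_ne hc
    (winners_av_eq_of_beats (card_winners_av hk A) fun w hw x hx => ?_)
  have hwx := beats_of_mem_winners_av hw hx
  have hx0 := h.score_eq_zero_of_notMem_winners_av hk hx
  have hxc : x ≠ c := (ne_of_mem_of_not_mem hcW hx).symm
  rw [beats_av_iff] at hwx ⊢
  rw [score_update_of_mem_iff (x := x) (by simp [hxc])]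
  by_cases hwc : w = c
  · subst hwc
    have := score_update_erase_add_one hc
    left; omega
  · rwa [score_update_of_mem_iff (by simp [hwc])]

end ApprovalVoting

/-- in a lazy-PNE of the AV-rule, unelected candidates have approval score `0`
and elected candidates have approval score at most `1`. -/
theorem statement_7 {N C : Type*} [Fintype N] [DecidableEq N] [Fintype C] [LinearOrder C]
    (k : ℕ) (hk1 : 1 ≤ k) (hk2 : k ≤ Fintype.card C)
    (u : N → C → ℝ) (hu : ∀ i, Function.Injective (u i))
    (lam : N → ℕ → ℝ) (hlam : ∀ i n, 0 ≤ lam i n)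
    (hlamne : ∀ i, ∃ n < k, lam i n ≠ 0)
    (A : N → Finset C)
    (hPNE : LazyPNE (fun _ n => (n : ℝ)) k lam u A) :
    (∀ c : C, c ∉ winners (fun _ n => (n : ℝ)) k A → score A c = 0) ∧
      (∀ c : C, c ∈ winners (fun _ n => (n : ℝ)) k A → score A c ≤ 1) := by
  exact ⟨fun _ hc => hPNE.score_eq_zero_of_notMem_winners_av hk2 hc,
    fun c _ => hPNE.score_le_one_av hk2 c⟩
end

section
/- A lazy-PNE need not exist even for k = 1: there exist a finite voter set N, a finite candidate set C, injective utility functions u_i : C → ℝ, positive weights λ^{(i)}_1 > 0 for each voter, and a linear priority order ▷ on C such that, for the AV-rule with lexicographic tie-breaking and committee size k = 1, no ballot profile A is a lazy-PNE. -/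
open Finset

/-- A committee with a single member `c` has utility `lam 0 * u c`. -/
theorem owaUtil_singleton {C : Type*} (lam : ℕ → ℝ) (u : C → ℝ) (c : C) :
    owaUtil lam u {c} = lam 0 * u c := by
  simp [owaUtil, owaRank, Finset.filter_singleton]

/-- The approval winner between the candidates `false` and `true`, ties going to `false`. -/
def approvalWinner {N : Type*} [Fintype N] (A : N → Finset Bool) : Bool :=
  decide (score A false < score A true)

theorem winners_bool {N : Type*} [Fintype N] (A : N → Finset Bool) :
    winners (fun _ n => (n : ℝ)) 1 A = {approvalWinner A} := by
  classical
  ext c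
  by_cases h : score A false < score A true
  · cases c <;>
      simp [winners, beats, approvalWinner, h, Finset.filter_eq_empty_iff, h.le, h.ne]
  · have h' := not_lt.mp h
    cases c <;>
      simp [winners, beats, approvalWinner, h, Finset.filter_eq_empty_iff, h', h'.ge_iff_eq']

/-- The utility of a voter who wants the candidate `i` elected. -/
def matchUtil (i c : Bool) : ℝ := if c = i then 1 else 0

theorem matchUtil_injective (i : Bool) : Function.Injective (matchUtil i) := by
  cases i <;> intro a b <;> cases a <;> cases b <;> simp [matchUtil]

theorem bestResponse_matchUtil_iff (A : Bool → Finset Bool) (i : Bool) (B : Finset Bool) :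
    BestResponse (fun _ n => (n : ℝ)) 1 (fun _ => 1) (matchUtil i) A i B ↔
      ∀ B' : Finset Bool, approvalWinner (Function.update A i B') = i →
        approvalWinner (Function.update A i B) = i := by
  refine forall_congr' fun B' => ?_
  rw [winners_bool, winners_bool, owaUtil_singleton, owaUtil_singleton]
  unfold matchUtil
  split_ifs <;> simp_all

theorem not_lazyPNE_matchUtil (A : Bool → Finset Bool) :
    ¬ LazyPNE (fun _ n => (n : ℝ)) 1 (fun _ _ => 1) matchUtil A := by
  simp only [LazyPNE, MinimalBestResponse, bestResponse_matchUtil_iff]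
  revert A
  decide

/-- a lazy-PNE need not exist, even for committee size `k = 1`. -/
theorem statement_8 :
    ∃ (N C : Type) (_ : Fintype N) (_ : DecidableEq N) (_ : Fintype C) (_ : LinearOrder C)
      (u : N → C → ℝ) (lam : N → ℕ → ℝ),
      (∀ i, Function.Injective (u i)) ∧ (∀ i, 0 < lam i 0) ∧
        ∀ A : N → Finset C, ¬ LazyPNE (fun _ n => (n : ℝ)) 1 lam u A := by
  exact ⟨Bool, Bool, inferInstance, inferInstance, inferInstance, inferInstance, matchUtil,
    fun _ _ => 1, matchUtil_injective, fun _ => one_pos, not_lazyPNE_matchUtil⟩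
end
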